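/- Let ω > 0, B₀ ∈ ℝ, q₀ ∈ ℝ, x₀ ∈ ℝ⁴, and let n ∈ ℝ⁴ be a unit timelike vector (η(n,n) = 1). Define S_μ(x,q) := [ −(ω/2)(B₀²/ω² + q²) tan(ω·η(n, x−x₀)) + B₀ q sec(ω·η(n, x−x₀)) ] n_μ and φ(x) := q₀ cos(ω·η(n, x−x₀)) + (B₀/ω) sin(ω·η(n, x−x₀)). Then at every x with cos(ω·η(n, x−x₀)) ≠ 0, φ satisfies the classical guiding law ∂φ/∂x^μ (x) = ∂S_μ/∂q (x, φ(x)) for each μ; explicitly, ∂φ/∂x^μ(x) = [ −ω tan(ω·η(n,x−x₀)) φ(x) + B₀ sec(ω·η(n,x−x₀)) ] n_μ. Moreover φ(x₀) = q₀ and ∂φ/∂x^μ(x₀) = B₀ n_μ. -/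

import Mathlib

noncomputable section

/-- The Minkowski metric `η = diag(1,-1,-1,-1)` on `ℝ⁴`. -/
def mink (μ ν : Fin 4) : ℝ := if μ = ν then (if μ = 0 then 1 else -1) else 0

/-- The Minkowski bilinear form on `ℝ⁴`. -/
def etaBil (v w : Fin 4 → ℝ) : ℝ := ∑ μ, ∑ ν, mink μ ν * v μ * w ν

/-- Partial derivative in `x^μ` of a function on `ℝ⁴`. -/
def pdx4 (μ : Fin 4) (F : (Fin 4 → ℝ) → ℝ) : (Fin 4 → ℝ) → ℝ :=
  fun x => fderiv ℝ F x (Pi.single μ 1)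

/-- The covector `w ↦ η(v, w)` as a continuous linear map. -/
def etaBilCLM (v : Fin 4 → ℝ) : (Fin 4 → ℝ) →L[ℝ] ℝ :=
  ∑ μ, ∑ ν, (mink μ ν * v μ) • ContinuousLinearMap.proj (R := ℝ) (φ := fun _ : Fin 4 => ℝ) ν

theorem etaBilCLM_apply (v w : Fin 4 → ℝ) : etaBilCLM v w = etaBil v w := by
  simp [etaBilCLM, etaBil]

theorem mink_comm (μ ν : Fin 4) : mink μ ν = mink ν μ := by
  unfold mink
  by_cases h : μ = ν
  · rw [h]
  · rw [if_neg h, if_neg (Ne.symm h)]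

theorem etaBil_single (v : Fin 4 → ℝ) (μ : Fin 4) :
    etaBil v (Pi.single μ 1) = ∑ ν, mink μ ν * v ν := by
  simp [etaBil, Pi.single_apply, mink_comm μ]

/-- Chain rule for a function of the phase `ω η(v, x - x₀)`. -/
theorem pdx4_comp_phase {f : ℝ → ℝ} {f' ω : ℝ} {v x₀ x : Fin 4 → ℝ}
    (hf : HasDerivAt f f' (ω * etaBil v (x - x₀))) (μ : Fin 4) :
    pdx4 μ (fun y => f (ω * etaBil v (y - x₀))) x = f' * (ω * ∑ ν, mink μ ν * v ν) := by
  have hphase : HasFDerivAt (fun y => ω * etaBil v (y - x₀)) (ω • etaBilCLM v) x := by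
    simp only [← etaBilCLM_apply]
    exact ((etaBilCLM v).hasFDerivAt.comp x ((hasFDerivAt_id x).sub_const x₀)).const_mul ω
  have h := hf.comp_hasFDerivAt x hphase
  rw [pdx4, show (fun y => f (ω * etaBil v (y - x₀)))
    = f ∘ fun y => ω * etaBil v (y - x₀) from rfl, h.fderiv]
  simp [etaBilCLM_apply, etaBil_single]

/-- The harmonic-oscillator field `φ(x) = q₀ cos(ω η(n,x−x₀)) + (B₀/ω) sin(ω η(n,x−x₀))`
satisfies the classical guiding law `∂_μ φ(x) = ∂S_μ/∂q(x,φ(x))` for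
`S_μ(x,q) = [−(ω/2)(B₀²/ω² + q²) tan(ω η(n,x−x₀)) + B₀ q sec(ω η(n,x−x₀))] n_μ`,
wherever `cos(ω η(n,x−x₀)) ≠ 0`; explicitly
`∂_μ φ(x) = [−ω tan(ω η(n,x−x₀)) φ(x) + B₀ sec(ω η(n,x−x₀))] n_μ`.
Moreover `φ(x₀) = q₀` and `∂_μ φ(x₀) = B₀ n_μ`. -/
theorem harmonic_oscillator_guiding_law
    (ω B₀ q₀ : ℝ) (hω : 0 < ω)
    (x₀ : Fin 4 → ℝ)
    (nv : Fin 4 → ℝ) (hnv : etaBil nv nv = 1)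
    (nlow : Fin 4 → ℝ) (hnlow : ∀ μ, nlow μ = ∑ ν, mink μ ν * nv ν)
    (S : (Fin 4 → ℝ) → ℝ → Fin 4 → ℝ)
    (hS : ∀ x q μ, S x q μ =
        (-(ω / 2) * (B₀ ^ 2 / ω ^ 2 + q ^ 2) * Real.tan (ω * etaBil nv (x - x₀))
          + B₀ * q * (Real.cos (ω * etaBil nv (x - x₀)))⁻¹) * nlow μ)
    (φ : (Fin 4 → ℝ) → ℝ)
    (hφ : ∀ x, φ x = q₀ * Real.cos (ω * etaBil nv (x - x₀))
        + (B₀ / ω) * Real.sin (ω * etaBil nv (x - x₀))) :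
    (∀ x, Real.cos (ω * etaBil nv (x - x₀)) ≠ 0 → ∀ μ,
      pdx4 μ φ x = deriv (fun q => S x q μ) (φ x) ∧
      pdx4 μ φ x = (-ω * Real.tan (ω * etaBil nv (x - x₀)) * φ x
          + B₀ * (Real.cos (ω * etaBil nv (x - x₀)))⁻¹) * nlow μ) ∧
    φ x₀ = q₀ ∧ (∀ μ, pdx4 μ φ x₀ = B₀ * nlow μ) := by
  have hgrad : ∀ x μ, pdx4 μ φ x =
      (-q₀ * ω * Real.sin (ω * etaBil nv (x - x₀))
        + B₀ * Real.cos (ω * etaBil nv (x - x₀))) * nlow μ := by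
    intro x μ
    have h := pdx4_comp_phase (x₀ := x₀) (x := x) (v := nv) (ω := ω)
      (((Real.hasDerivAt_cos (ω * etaBil nv (x - x₀))).const_mul q₀).add
        ((Real.hasDerivAt_sin (ω * etaBil nv (x - x₀))).const_mul (B₀ / ω))) μ
    rw [funext hφ, hnlow μ]
    refine h.trans ?_
    field_simp
  have hzero : etaBil nv 0 = 0 := by simp [etaBil]
  refine ⟨fun x hx μ => ?_, by simp [hφ, hzero], fun μ => by simp [hgrad, hzero]⟩
  have hguide : pdx4 μ φ x = (-ω * Real.tan (ω * etaBil nv (x - x₀)) * φ x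
      + B₀ * (Real.cos (ω * etaBil nv (x - x₀)))⁻¹) * nlow μ := by
    rw [hgrad, hφ, Real.tan_eq_sin_div_cos]
    congr 1
    field_simp
    linear_combination B₀ * Real.sin_sq_add_cos_sq (ω * etaBil nv (x - x₀))
  refine ⟨hguide.trans ?_, hguide⟩
  simp only [hS]
  have hq := hasDerivAt_id (φ x)
  have hderiv := (((((hq.pow 2).const_add (B₀ ^ 2 / ω ^ 2)).const_mul (-(ω / 2))).mul_const
    (Real.tan (ω * etaBil nv (x - x₀)))).add ((hq.const_mul B₀).mul_const
      (Real.cos (ω * etaBil nv (x - x₀)))⁻¹)).mul_const (nlow μ)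
  refine Eq.trans ?_ hderiv.deriv.symm
  simp only [id]
  ring
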